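/- Let A ⊆ ℝⁿ be a generic antichain, m ≥ 1, and b : Fin m → ℝⁿ an injective map whose range is an A-neighborly subset of A. For j ∈ Fin m define c(j) := ⋁ { b(i) : i ≤ j }. Then the convex hull of { c(0), …, c(m−1) } is contained in the topological frontier of dmA. -/

import Mathlib

/-- `B` is `A`-neighborly: `B` is nonempty, bounded above, and no point of `A`
is strictly below (in every coordinate) the coordinatewise supremum of `B`. -/
def IsNbly {n : ℕ} (A B : Set (Fin n → ℝ)) : Prop :=
  B.Nonempty ∧ BddAbove B ∧ ∀ a ∈ A, ¬ ∀ i, a i < sSup B i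

/-- `A` is generic: for every `A`-neighborly subset `B ⊆ A` and each coordinate `i`,
there is at most one element of `A` in the `i`-th face of the bonnet over `B`. -/
def IsGeneric {n : ℕ} (A : Set (Fin n → ℝ)) : Prop :=
  ∀ B ⊆ A, IsNbly A B → ∀ i : Fin n,
    Set.Subsingleton {a ∈ A | a ≤ sSup B ∧ a i = sSup B i}

/-- `A` is an antichain for the coordinatewise partial order. -/
def IsAntichainLe {n : ℕ} (A : Set (Fin n → ℝ)) : Prop :=
  ∀ x ∈ A, ∀ y ∈ A, x ≤ y → x = y

/-- `M` is a maximal `A`-neighborly subset of `A`. -/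
def IsMaxNbly {n : ℕ} (A M : Set (Fin n → ℝ)) : Prop :=
  M ⊆ A ∧ IsNbly A M ∧ ∀ M' ⊆ A, IsNbly A M' → M ⊆ M' → M' = M

/-- `mA`: the set of suprema of maximal `A`-neighborly subsets of `A`. -/
def mSet {n : ℕ} (A : Set (Fin n → ℝ)) : Set (Fin n → ℝ) :=
  {x | ∃ M, IsMaxNbly A M ∧ x = sSup M}

/-- `dmA = mA - 𝕆ⁿ`: the down-set generated by `mA`. -/
def dmSet {n : ℕ} (A : Set (Fin n → ℝ)) : Set (Fin n → ℝ) :=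
  {x | ∃ m ∈ mSet A, x ≤ m}

/-- A neighborly subset of a generic set has at most one point per coordinate. -/
theorem IsNbly.finite_and_ncard_le {n : ℕ} {A M : Set (Fin n → ℝ)} (hA : IsGeneric A)
    (hMA : M ⊆ A) (hM : IsNbly A M) : M.Finite ∧ M.ncard ≤ n := by
  have hface : ∀ a : M, ∃ i, (a : Fin n → ℝ) i = sSup M i := by
    rintro ⟨a, ha⟩
    by_contra! hne
    exact hM.2.2 a (hMA ha) fun i => lt_of_le_of_ne (le_csSup hM.2.1 ha i) (hne i)
  choose f hf using hface
  have hf_inj : Function.Injective f := by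
    intro x y hxy
    apply Subtype.ext
    exact hA M hMA hM (f x) ⟨hMA x.2, le_csSup hM.2.1 x.2, hf x⟩
      ⟨hMA y.2, le_csSup hM.2.1 y.2, hxy ▸ hf y⟩
  have : Finite M := Finite.of_injective f hf_inj
  refine ⟨Set.toFinite M, ?_⟩
  simpa [Nat.card_coe_set_eq] using Nat.card_le_card_of_injective f hf_inj

/-- In a generic set, every neighborly subset extends to a maximal one. -/
theorem IsNbly.exists_isMaxNbly_superset {n : ℕ} {A B : Set (Fin n → ℝ)} (hA : IsGeneric A)
    (hBA : B ⊆ A) (hB : IsNbly A B) : ∃ M, IsMaxNbly A M ∧ B ⊆ M := by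
  let S : Set ℕ := {k | ∃ M ⊆ A, IsNbly A M ∧ B ⊆ M ∧ M.ncard = k}
  have hS : BddAbove S := by
    refine ⟨n, ?_⟩
    rintro k ⟨M, hMA, hM, -, rfl⟩
    exact (hM.finite_and_ncard_le hA hMA).2
  obtain ⟨M, hMA, hM, hBM, hcard⟩ :=
    Nat.sSup_mem (s := S) ⟨_, B, hBA, hB, Set.Subset.rfl, rfl⟩ hS
  refine ⟨M, ⟨hMA, hM, fun M' hM'A hM' hMM' => ?_⟩, hBM⟩
  refine (Set.eq_of_subset_of_ncard_le hMM' ?_ (hM'.finite_and_ncard_le hA hM'A).1).symm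
  exact hcard ▸ le_csSup hS ⟨M', hM'A, hM', hBM.trans hMM', rfl⟩

/-- An interior point of `dmSet A` does not lie above any point of `A`. -/
theorem notMem_interior_dmSet {n : ℕ} {A : Set (Fin n → ℝ)} {a x : Fin n → ℝ}
    (ha : a ∈ A) (hax : a ≤ x) : x ∉ interior (dmSet A) := by
  intro hx
  obtain ⟨ε, hε, hball⟩ := Metric.isOpen_iff.1 isOpen_interior x hx
  have hmem : (x + fun _ => ε / 2) ∈ Metric.ball x ε := by
    rw [Metric.mem_ball, dist_pi_lt_iff hε]
    intro i
    simp [abs_of_pos hε, hε]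
  obtain ⟨_, ⟨M, hM, rfl⟩, hle⟩ := interior_subset (hball hmem)
  refine hM.2.1.2.2 a ha fun i => ?_
  have h₁ := hax i
  have h₂ := hle i
  simp only [Pi.add_apply] at h₂
  linarith

theorem stmt14 {n : ℕ} (A : Set (Fin n → ℝ)) (hA : IsGeneric A)
    (hac : IsAntichainLe A) (m : ℕ) (hm : 1 ≤ m) (b : Fin m → (Fin n → ℝ))
    (hinj : Function.Injective b) (hrange : Set.range b ⊆ A)
    (hnb : IsNbly A (Set.range b)) :
    convexHull ℝ (Set.range fun j : Fin m => sSup (b '' {i | i ≤ j})) ⊆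
      frontier (dmSet A) := by
  let i₀ : Fin m := ⟨0, hm⟩
  have hbdd : ∀ j, BddAbove (b '' {i | i ≤ j}) := fun j =>
    hnb.2.1.mono (Set.image_subset_range _ _)
  have hhull : convexHull ℝ (Set.range fun j : Fin m => sSup (b '' {i | i ≤ j})) ⊆
      Set.Icc (b i₀) (sSup (Set.range b)) := by
    refine convexHull_min ?_ (convex_Icc _ _)
    rintro _ ⟨j, rfl⟩
    have h₀ : b i₀ ∈ b '' {i | i ≤ j} :=
      Set.mem_image_of_mem b (Fin.le_def.2 (Nat.zero_le _))
    exact ⟨le_csSup (hbdd j) h₀,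
      csSup_le_csSup hnb.2.1 ⟨_, h₀⟩ (Set.image_subset_range _ _)⟩
  obtain ⟨M, hM, hBM⟩ := hnb.exists_isMaxNbly_superset hA hrange
  intro x hx
  obtain ⟨hx₁, hx₂⟩ := hhull hx
  exact ⟨subset_closure ⟨_, ⟨M, hM, rfl⟩,
      hx₂.trans (csSup_le_csSup hM.2.1.2.1 hnb.1 hBM)⟩,
    notMem_interior_dmSet (hrange ⟨i₀, rfl⟩) hx₁⟩
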